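/- Let φ: [a,b] → ℝ^{n−1} be a differentiable curve whose image is not contained in a proper affine subspace, and let V be a finite-dimensional normed representation of G = SL(n,ℝ) with no nonzero G-fixed vectors. Then for every C > 0 there exists t₀ > 0 such that for all v ∈ V and all t > t₀: sup_{s∈[a,b]} ‖a_t u(φ(s)) v‖ ≥ C‖v‖. -/

import Mathlib

noncomputable section

open Matrix

/-- `X(ξ)`: first row `(0, ξ)`, zeros elsewhere. -/
def Xmat (m : ℕ) (ξ : Fin m → ℝ) : Matrix (Fin (m + 1)) (Fin (m + 1)) ℝ :=
  Matrix.of (Fin.cons (Fin.cons 0 ξ) 0)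

/-- `u(ξ)`: unipotent matrix with `1`s on the diagonal and first row `(1, ξ)`. -/
def uMat (m : ℕ) (ξ : Fin m → ℝ) : Matrix (Fin (m + 1)) (Fin (m + 1)) ℝ :=
  1 + Xmat m ξ

lemma Xmat_apply_succ (m : ℕ) (ξ : Fin m → ℝ) (i : Fin m) (j : Fin (m + 1)) :
    Xmat m ξ i.succ j = 0 := by
  simp [Xmat]

lemma uMat_det (m : ℕ) (ξ : Fin m → ℝ) : (uMat m ξ).det = 1 := by
  have h : (uMat m ξ).BlockTriangular id := by
    intro i j hij
    have hi : i ≠ 0 := by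
      rintro rfl; exact Fin.not_lt_zero j hij
    obtain ⟨i', rfl⟩ := Fin.eq_succ_of_ne_zero hi
    have hne : (i'.succ : Fin (m+1)) ≠ j := by
      intro h; subst h; exact lt_irrefl _ hij
    simp [uMat, Matrix.one_apply, hne, Xmat_apply_succ]
  rw [Matrix.det_of_upperTriangular h]
  have : ∀ i, uMat m ξ i i = 1 := by
    intro i
    rcases Fin.eq_zero_or_eq_succ i with rfl | ⟨i', rfl⟩
    · simp [uMat, Xmat, Matrix.one_apply]
    · simp [uMat, Matrix.one_apply, Xmat_apply_succ]
  simp [this]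

/-- `u(ξ)` as an element of `SL(n, ℝ)`. -/
def uSL (m : ℕ) (ξ : Fin m → ℝ) : Matrix.SpecialLinearGroup (Fin (m + 1)) ℝ :=
  ⟨uMat m ξ, uMat_det m ξ⟩

/-- The diagonal matrix `a_t = diag(e^{(n-1)t}, e^{-t}, …, e^{-t})`. -/
def aMat (m : ℕ) (t : ℝ) : Matrix (Fin (m + 1)) (Fin (m + 1)) ℝ :=
  Matrix.diagonal (Fin.cons (Real.exp (m * t)) fun _ => Real.exp (-t))

lemma aMat_det (m : ℕ) (t : ℝ) : (aMat m t).det = 1 := by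
  rw [aMat, Matrix.det_diagonal, Fin.prod_cons]
  simp only [Finset.prod_const, Finset.card_univ, Fintype.card_fin]
  rw [← Real.exp_nat_mul, ← Real.exp_add]
  ring_nf
  exact Real.exp_zero

/-- `a_t` as an element of `SL(n, ℝ)`. -/
def aSL (m : ℕ) (t : ℝ) : Matrix.SpecialLinearGroup (Fin (m + 1)) ℝ :=
  ⟨aMat m t, aMat_det m t⟩

/-- Topology on `SL(n, ℝ)`, induced from the space of matrices. -/
instance SLtop (m : ℕ) : TopologicalSpace (Matrix.SpecialLinearGroup (Fin (m + 1)) ℝ) :=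
  TopologicalSpace.induced
    (fun g => (g : Matrix (Fin (m + 1)) (Fin (m + 1)) ℝ)) inferInstance

variable {V : Type*} [AddCommGroup V] [Module ℝ V]

/-- The weight space `V^μ` of the one-parameter diagonal group `{a_t}` acting through
the representation `ρ`: the set of `v` with `ρ(a_t) v = e^{μ t} v` for all `t`. -/
def wtSpace (m : ℕ)
    (ρ : Matrix.SpecialLinearGroup (Fin (m + 1)) ℝ →* Module.End ℝ V) (μ : ℝ) :
    Submodule ℝ V :=
  ⨅ t : ℝ, Module.End.eigenspace (ρ (aSL m t)) (Real.exp (μ * t))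

section SlTwo

variable {W : Type*} [AddCommGroup W] [Module ℝ W]

lemma pow_nilpotent_of_commutator [FiniteDimensional ℝ W] {H E : Module.End ℝ W} {c : ℝ}
    (hc : c ≠ 0) (h : H * E - E * H = c • E) : ∃ k, E ^ k = 0 := by
  by_contra! hne
  have hpow : ∀ k : ℕ, H * E ^ k - E ^ k * H = ((k : ℝ) * c) • E ^ k := by
    intro k
    induction k with
    | zero => simp
    | succ k ih =>
      have h1 : H * E = E * H + c • E := by rw [← h]; abel
      have h2 : H * E ^ k = E ^ k * H + ((k : ℝ) * c) • E ^ k := by rw [← ih]; abel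
      rw [pow_succ, ← mul_assoc, h2, add_mul, mul_assoc, h1, mul_add, ← mul_assoc]
      simp only [smul_mul_assoc, mul_smul_comm]
      push_cast
      module
  let D : Module.End ℝ (Module.End ℝ W) := LinearMap.mulLeft ℝ H - LinearMap.mulRight ℝ H
  have hli := Module.End.eigenvectors_linearIndependent' D (fun k : ℕ => (k : ℝ) * c)
    (fun a b hab => by simpa [hc] using hab) (fun k => E ^ k) (fun k =>
      ⟨by rw [Module.End.mem_eigenspace_iff]; simpa [D] using hpow k, hne k⟩)
  have := hli.finite
  exact not_finite ℕ

variable {E F H : Module.End ℝ W}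

lemma weight_pow_apply (hHE : ∀ x, H (E x) = E (H x) + (2 : ℝ) • E x) (r : ℕ) (x : W) :
    H ((E ^ r) x) = (E ^ r) (H x) + (2 * r : ℝ) • (E ^ r) x := by
  induction r generalizing x with
  | zero => simp
  | succ r ih =>
    rw [pow_succ, Module.End.mul_apply, Module.End.mul_apply, ih, hHE, map_add, map_smul]
    push_cast
    module

lemma raise_lower_pow (hHF : ∀ x, H (F x) = F (H x) - (2 : ℝ) • F x)
    (hEF : ∀ x, E (F x) = F (E x) + H x) (k : ℕ) {x : W} (hx : E x = 0) :
    E ((F ^ (k + 1)) x) = ((k : ℝ) + 1) • (F ^ k) (H x - (k : ℝ) • x) := by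
  have hF : ∀ r : ℕ, ∀ x, H ((F ^ r) x) = (F ^ r) (H x) - (2 * r : ℝ) • (F ^ r) x := by
    intro r
    induction r with
    | zero => simp
    | succ r ih =>
      intro x
      rw [pow_succ, Module.End.mul_apply, Module.End.mul_apply, ih, hHF, map_sub, map_smul]
      push_cast
      module
  induction k with
  | zero => simp [hEF, hx]
  | succ k ih =>
    rw [pow_succ' F (k + 1), Module.End.mul_apply, hEF, ih, hF, map_smul,
      ← Module.End.mul_apply F, ← pow_succ', map_sub, map_sub, map_smul, map_smul]
    push_cast
    module

lemma raise_pow_lower_pow (hHF : ∀ x, H (F x) = F (H x) - (2 : ℝ) • F x)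
    (hEF : ∀ x, E (F x) = F (E x) + H x) (k : ℕ) {x : W} (hx : E x = 0) :
    (E ^ (k + 1)) ((F ^ (k + 1)) x) =
      ((k : ℝ) + 1) • (E ^ k) ((F ^ k) (H x - (k : ℝ) • x)) := by
  rw [pow_succ E, Module.End.mul_apply, raise_lower_pow hHF hEF k hx, map_smul]

lemma raise_weight_sub (hHE : ∀ x, H (E x) = E (H x) + (2 : ℝ) • E x) (c : ℝ) {x : W}
    (hx : E x = 0) : E (H x - c • x) = 0 := by
  have := hHE x
  rw [hx] at this
  simp only [map_zero, smul_zero, add_zero] at this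
  simp [← this, hx]

lemma raise_pow_lower_pow_primitive (hHF : ∀ x, H (F x) = F (H x) - (2 : ℝ) • F x)
    (hEF : ∀ x, E (F x) = F (E x) + H x) (k : ℕ) {x : W} {μ : ℝ} (hx : E x = 0)
    (hμ : H x = μ • x) :
    (E ^ k) ((F ^ k) x) = (∏ j ∈ Finset.range k, ((j : ℝ) + 1) * (μ - j)) • x := by
  induction k with
  | zero => simp
  | succ k ih =>
    rw [raise_pow_lower_pow hHF hEF k hx, hμ, ← sub_smul, map_smul, map_smul, ih,
      Finset.prod_range_succ]
    module

lemma primitive_weight_nonneg (hHF : ∀ x, H (F x) = F (H x) - (2 : ℝ) • F x)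
    (hEF : ∀ x, E (F x) = F (E x) + H x) {d : ℕ} (hF : F ^ d = 0) {x : W} {μ : ℝ}
    (hx : E x = 0) (hμ : H x = μ • x) (hx0 : x ≠ 0) : 0 ≤ μ := by
  have h := raise_pow_lower_pow_primitive hHF hEF d hx hμ
  rw [hF] at h
  simp only [LinearMap.zero_apply, map_zero] at h
  have h0 := (smul_eq_zero.mp h.symm).resolve_right hx0
  obtain ⟨j, -, hj⟩ := Finset.prod_eq_zero_iff.mp h0
  have : (j : ℝ) + 1 ≠ 0 := by positivity
  have h1 : μ - j = 0 := (mul_eq_zero.mp hj).resolve_left this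
  have : μ = j := by linarith
  rw [this]
  positivity

/-- The Cartan element acts semisimply on the vectors annihilated by the raising operator. -/
lemma weight_semisimple_on_primitive (hHE : ∀ x, H (E x) = E (H x) + (2 : ℝ) • E x)
    (hHF : ∀ x, H (F x) = F (H x) - (2 : ℝ) • F x)
    (hEF : ∀ x, E (F x) = F (E x) + H x) (μ : ℝ) (k : ℕ) {x y : W} (hx : E x = 0)
    (hk : (E ^ k) ((F ^ k) x) = 0) (hxy : H x = μ • x + y) (hy : H y = μ • y) : y = 0 := by
  induction k generalizing x y with
  | zero =>
    have : x = 0 := by simpa using hk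
    simpa [this] using hxy.symm
  | succ k ih =>
    rw [raise_pow_lower_pow hHF hEF k hx] at hk
    have hk' := (smul_eq_zero.mp hk).resolve_left (by positivity)
    by_cases hμ : μ = k
    · have hyx : H x - (k : ℝ) • x = y := by rw [hxy, hμ]; abel
      rw [hyx, raise_pow_lower_pow_primitive hHF hEF k
        (hyx ▸ raise_weight_sub hHE _ hx) hy] at hk'
      refine (smul_eq_zero.mp hk').resolve_left (Finset.prod_ne_zero_iff.mpr fun j hj => ?_)
      have hjk : (j : ℝ) < k := by exact_mod_cast Finset.mem_range.mp hj
      rw [hμ]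
      exact mul_ne_zero (by positivity) (sub_pos.mpr hjk).ne'
    · have h0 : (μ - k) • y = 0 := by
        refine ih (raise_weight_sub hHE _ hx) hk' ?_ ?_
        · rw [map_sub, map_smul, hxy, map_add, map_smul, hxy, hy]; module
        · rw [map_smul, hy]; module
      exact (smul_eq_zero.mp h0).resolve_left (sub_ne_zero.mpr hμ)

/-- The Casimir operator of a triple `(H, E, F)`. -/
def casimirOp (H E F : Module.End ℝ W) : Module.End ℝ W :=
  (4 : ℝ) • (F * E) + H * H + (2 : ℝ) • H

lemma casimirOp_apply (x : W) :
    casimirOp H E F x = (4 : ℝ) • F (E x) + H (H x) + (2 : ℝ) • H x := by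
  simp [casimirOp]

lemma casimirOp_primitive {x : W} {μ : ℝ} (hx : E x = 0) (hμ : H x = μ • x) :
    casimirOp H E F x = (μ * (μ + 2)) • x := by
  rw [casimirOp_apply, hx, hμ, map_smul, hμ, map_zero]
  module

lemma casimirOp_weight (hHE : ∀ x, H (E x) = E (H x) + (2 : ℝ) • E x)
    (hHF : ∀ x, H (F x) = F (H x) - (2 : ℝ) • F x) (x : W) :
    H (casimirOp H E F x) = casimirOp H E F (H x) := by
  simp only [casimirOp_apply, map_add, map_smul, hHF, hHE]
  module

lemma casimirOp_raise (hHE : ∀ x, H (E x) = E (H x) + (2 : ℝ) • E x)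
    (hEF : ∀ x, E (F x) = F (E x) + H x) (x : W) :
    E (casimirOp H E F x) = casimirOp H E F (E x) := by
  have h : ∀ x, E (H x) = H (E x) - (2 : ℝ) • E x := fun x => by rw [hHE]; abel
  simp only [casimirOp_apply, map_add, map_smul, hEF, h, map_sub]
  module

lemma casimirOp_raise_pow (hHE : ∀ x, H (E x) = E (H x) + (2 : ℝ) • E x)
    (hEF : ∀ x, E (F x) = F (E x) + H x) (r : ℕ) (x : W) :
    (E ^ r) (casimirOp H E F x) = casimirOp H E F ((E ^ r) x) := by
  induction r generalizing x with
  | zero => simp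
  | succ r ih =>
    rw [pow_succ, Module.End.mul_apply, Module.End.mul_apply, casimirOp_raise hHE hEF, ih]

lemma weight_semisimple_of_primitive (hHE : ∀ x, H (E x) = E (H x) + (2 : ℝ) • E x)
    (hHF : ∀ x, H (F x) = F (H x) - (2 : ℝ) • F x)
    (hEF : ∀ x, E (F x) = F (E x) + H x) {d : ℕ} (hF : F ^ d = 0) {κ : ℝ} (hκ : 0 ≤ κ)
    (r : ℕ) {x z : W} (hr : (E ^ (r + 1)) x = 0) (hxz : H x = κ • x + z) (hz : H z = κ • z)
    (hEz : E z = 0) : z = 0 := by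
  induction r generalizing x z with
  | zero =>
    exact weight_semisimple_on_primitive hHE hHF hEF κ d (by simpa using hr) (by simp [hF]) hxz hz
  | succ r ih =>
    set c : ℝ := (κ + 2 * (r + 1)) * (κ + 2 * (r + 1) + 2)
    have hw1 : E ((E ^ (r + 1)) x) = 0 := by
      rw [← Module.End.mul_apply, ← pow_succ']; exact hr
    have hw2 : H ((E ^ (r + 1)) x) = (κ + 2 * (r + 1)) • (E ^ (r + 1)) x := by
      rw [weight_pow_apply hHE, hxz, map_add, map_smul, pow_succ E r, Module.End.mul_apply _ _ z,
        hEz, map_zero]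
      push_cast
      module
    have hCz := casimirOp_primitive (F := F) hEz hz
    have h0 : (κ * (κ + 2) - c) • z = 0 := by
      refine ih (x := casimirOp H E F x - c • x) ?_ ?_ ?_ ?_
      · rw [map_sub, map_smul, casimirOp_raise_pow hHE hEF, casimirOp_primitive hw1 hw2, sub_self]
      · rw [map_sub, map_smul, casimirOp_weight hHE hHF, hxz, map_add, map_smul, hCz]
        module
      · rw [map_smul, hz]; module
      · rw [map_smul, hEz, smul_zero]
    refine (smul_eq_zero.mp h0).resolve_left (ne_of_lt ?_)
    simp only [c]
    have : (0 : ℝ) ≤ r := Nat.cast_nonneg r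
    nlinarith

lemma weight_semisimple (hHE : ∀ x, H (E x) = E (H x) + (2 : ℝ) • E x)
    (hHF : ∀ x, H (F x) = F (H x) - (2 : ℝ) • F x)
    (hEF : ∀ x, E (F x) = F (E x) + H x) {d : ℕ} (hE : E ^ d = 0) (hF : F ^ d = 0) {μ : ℝ}
    {x y : W} (hxy : H x = μ • x + y) (hy : H y = μ • y) : y = 0 := by
  by_contra hy0
  classical
  have hex : ∃ j, (E ^ j) y = 0 := ⟨d, by simp [hE]⟩
  obtain ⟨j, hj⟩ : ∃ j, Nat.find hex = j + 1 :=
    Nat.exists_eq_succ_of_ne_zero fun h => hy0 (by simpa [h] using Nat.find_spec hex)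
  have hj1 : (E ^ (j + 1)) y = 0 := hj ▸ Nat.find_spec hex
  have hj0 : (E ^ j) y ≠ 0 := Nat.find_min hex (by omega)
  have hEz : E ((E ^ j) y) = 0 := by rw [← Module.End.mul_apply, ← pow_succ']; exact hj1
  have hz : H ((E ^ j) y) = (μ + 2 * j) • (E ^ j) y := by
    rw [weight_pow_apply hHE, hy, map_smul]; module
  refine hj0 (weight_semisimple_of_primitive hHE hHF hEF hF
    (primitive_weight_nonneg hHF hEF hF hEz hz hj0) d (x := (E ^ j) x) ?_ ?_ hz hEz)
  · simp [pow_succ, hE]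
  · rw [weight_pow_apply hHE, hxy, map_add, map_smul]; module

lemma mem_iSup_eigenspace_of_sub_mem
    (hss : ∀ (μ : ℝ) (x y : W), H x = μ • x + y → H y = μ • y → y = 0) {s : ℝ} {x : W}
    (hx : H x - s • x ∈ ⨆ μ : ℝ, H.eigenspace μ) : x ∈ ⨆ μ : ℝ, H.eigenspace μ := by
  set U := ⨆ μ : ℝ, H.eigenspace μ with hU
  have hle : U ≤ H.eigenspace s ⊔ U.map (H - s • (1 : Module.End ℝ W)) := by
    refine iSup_le fun μ y hy => ?_
    by_cases hμ : μ = s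
    · exact hμ ▸ Submodule.mem_sup_left hy
    · refine Submodule.mem_sup_right
        ⟨(μ - s)⁻¹ • y, U.smul_mem _ (Submodule.mem_iSup_of_mem μ hy), ?_⟩
      have := sub_ne_zero.mpr hμ
      rw [map_smul, LinearMap.sub_apply, Module.End.mem_eigenspace_iff.mp hy, LinearMap.smul_apply,
        Module.End.one_apply, ← sub_smul, smul_smul, inv_mul_cancel₀ this, one_smul]
  obtain ⟨y, hy, _, ⟨u, hu, rfl⟩, hsum⟩ := Submodule.mem_sup.mp (hle hx)
  simp only [LinearMap.sub_apply, LinearMap.smul_apply, Module.End.one_apply] at hsum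
  rw [Module.End.mem_eigenspace_iff] at hy
  have hxu : H (x - u) = s • (x - u) + y := by
    rw [map_sub, smul_sub, eq_sub_of_add_eq hsum]
    abel
  have h0 := hss s (x - u) y hxu hy
  have hmem : x - u ∈ U := Submodule.mem_iSup_of_mem s
    (Module.End.mem_eigenspace_iff.mpr (by rw [hxu, h0, add_zero]))
  simpa using U.add_mem hmem hu

theorem slTwo_iSup_eigenspace_eq_top [FiniteDimensional ℝ W]
    (hHE : ∀ x, H (E x) = E (H x) + (2 : ℝ) • E x)
    (hHF : ∀ x, H (F x) = F (H x) - (2 : ℝ) • F x)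
    (hEF : ∀ x, E (F x) = F (E x) + H x) : ⨆ μ : ℝ, H.eigenspace μ = ⊤ := by
  obtain ⟨d₁, hd₁⟩ := pow_nilpotent_of_commutator (H := H) (E := E) (c := 2) (by norm_num)
    (by ext x; simp [hHE])
  obtain ⟨d₂, hd₂⟩ := pow_nilpotent_of_commutator (H := H) (E := F) (c := -2) (by norm_num)
    (by ext x; simp [hHF])
  have hE : E ^ (d₁ + d₂) = 0 := by rw [pow_add, hd₁, zero_mul]
  have hF : F ^ (d₁ + d₂) = 0 := by rw [pow_add, hd₂, mul_zero]
  have hss : ∀ (μ : ℝ) (x y : W), H x = μ • x + y → H y = μ • y → y = 0 :=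
    fun μ x y h1 h2 => weight_semisimple hHE hHF hEF hE hF h1 h2
  have key : ∀ r : ℕ, ∀ x, (E ^ r) x = 0 → x ∈ ⨆ μ : ℝ, H.eigenspace μ := by
    intro r
    induction r with
    | zero => intro x hx; simp only [pow_zero, Module.End.one_apply] at hx; simp [hx]
    | succ r ih =>
      have step : ∀ k : ℕ, ∀ x, (E ^ (r + 1)) x = 0 → (E ^ k) ((F ^ k) ((E ^ r) x)) = 0 →
          x ∈ ⨆ μ : ℝ, H.eigenspace μ := by
        intro k
        induction k with
        | zero => intro x _ hk; exact ih x (by simpa using hk)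
        | succ k ihk =>
          intro x hx hk
          have hx' : E ((E ^ r) x) = 0 := by rw [← Module.End.mul_apply, ← pow_succ']; exact hx
          rw [raise_pow_lower_pow hHF hEF k hx'] at hk
          have hk' := (smul_eq_zero.mp hk).resolve_left (by positivity)
          refine mem_iSup_eigenspace_of_sub_mem hss (s := k - 2 * r) (ihk _ ?_ ?_)
          · have := weight_pow_apply hHE (r + 1) x
            rw [hx, map_zero, smul_zero, add_zero] at this
            rw [map_sub, map_smul, hx, ← this, smul_zero, sub_zero]
          · rw [← hk', weight_pow_apply hHE, map_sub, map_smul]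
            congr 2
            module
      exact fun x hx => step (d₁ + d₂) x hx (by simp [hF])
  exact eq_top_iff.mpr fun x _ => key (d₁ + d₂) x (by simp [hE])

end SlTwo

section OneParameter

lemma exists_hasDerivAt_of_continuous_hom {𝔸 : Type*} [NormedRing 𝔸] [NormedAlgebra ℝ 𝔸]
    [CompleteSpace 𝔸] {Φ : ℝ → 𝔸} (hc : Continuous Φ) (h0 : Φ 0 = 1)
    (hadd : ∀ s t, Φ (s + t) = Φ s * Φ t) : ∃ A, HasDerivAt Φ A 0 := by
  have hΨ : ∀ x, HasDerivAt (fun x => ∫ y in (0 : ℝ)..x, Φ y) (Φ x) x := fun x =>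
    intervalIntegral.integral_hasDerivAt_right (hc.intervalIntegrable _ _)
      hc.aestronglyMeasurable.stronglyMeasurableAtFilter hc.continuousAt
  have hlim := (hΨ 0).tendsto_slope_zero_right
  simp only [zero_add, intervalIntegral.integral_same, sub_zero, h0] at hlim
  obtain ⟨δ, hδ, u, hu⟩ : ∃ δ : ℝ, 0 < δ ∧ IsUnit (δ⁻¹ • ∫ y in (0 : ℝ)..δ, Φ y) := by
    have h1 := hlim.eventually (Units.isOpen.mem_nhds (show IsUnit (1 : 𝔸) from isUnit_one))
    obtain ⟨δ, h2, h3⟩ := (h1.and self_mem_nhdsWithin).exists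
    exact ⟨δ, h3, h2⟩
  have hrep : ∀ x, Φ x = (δ⁻¹ • ((∫ y in (0 : ℝ)..(x + δ), Φ y) - ∫ y in (0 : ℝ)..x, Φ y)) *
      (↑u⁻¹ : 𝔸) := by
    intro x
    have hshift : Φ x * ∫ y in (0 : ℝ)..δ, Φ y = ∫ y in x..(x + δ), Φ y := by
      have h := (ContinuousLinearMap.mul ℝ 𝔸 (Φ x)).intervalIntegral_comp_comm
        (hc.intervalIntegrable (μ := MeasureTheory.volume) 0 δ)
      simp only [ContinuousLinearMap.mul_apply', ← hadd] at h
      rw [← h, intervalIntegral.integral_comp_add_left (fun y => Φ y) x, add_zero]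
    rw [Units.eq_mul_inv_iff_mul_eq, hu, mul_smul_comm, hshift,
      intervalIntegral.integral_interval_sub_left (hc.intervalIntegrable _ _)
        (hc.intervalIntegrable _ _)]
  have hd : DifferentiableAt ℝ Φ 0 := by
    rw [funext hrep]
    have h1 : DifferentiableAt ℝ (fun x => ∫ y in (0 : ℝ)..(x + δ), Φ y) 0 :=
      ((hΨ (0 + δ)).comp_add_const 0 δ).differentiableAt
    have h2 := (h1.sub (hΨ 0).differentiableAt).const_smul δ⁻¹
    exact h2.mul_const (↑u⁻¹ : 𝔸)
  exact ⟨_, hd.hasDerivAt⟩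

lemma hasDerivAt_of_hom {𝔸 : Type*} [NormedRing 𝔸] [NormedAlgebra ℝ 𝔸]
    {Φ : ℝ → 𝔸} (hadd : ∀ s t, Φ (s + t) = Φ s * Φ t) {A : 𝔸} (hA : HasDerivAt Φ A 0) (t : ℝ) :
    HasDerivAt Φ (Φ t * A) t := by
  have h1 : HasDerivAt (fun s => Φ t * Φ (s - t)) (Φ t * A) t :=
    HasDerivAt.const_mul _ (HasDerivAt.comp_sub_const t t (by rwa [sub_self]))
  refine h1.congr_of_eventuallyEq (Filter.Eventually.of_forall fun s => ?_)
  simp only [← hadd]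
  ring_nf

variable {W : Type*} [NormedAddCommGroup W] [NormedSpace ℝ W]

lemma apply_eigenvector_of_hom {Φ : ℝ → W →L[ℝ] W} (h0 : Φ 0 = 1)
    (hadd : ∀ s t, Φ (s + t) = Φ s * Φ t) {A : W →L[ℝ] W} (hA : HasDerivAt Φ A 0) {x : W} {μ : ℝ}
    (hx : A x = μ • x) (t : ℝ) : Φ t x = Real.exp (μ * t) • x := by
  have hd : ∀ t, HasDerivAt (fun t => Real.exp (-(μ * t)) • Φ t x) 0 t := by
    intro t
    have h1 : HasDerivAt (fun t => Φ t x) (μ • Φ t x) t := by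
      have := (hasDerivAt_of_hom hadd hA t).clm_apply (hasDerivAt_const t x)
      simpa [hx] using this
    have h2 : HasDerivAt (fun t => Real.exp (-(μ * t))) (Real.exp (-(μ * t)) * -μ) t := by
      simpa using (((hasDerivAt_id t).const_mul μ).neg).exp
    have h3 := h2.smul h1
    rwa [smul_smul, ← add_smul, show Real.exp (-(μ * t)) * μ + Real.exp (-(μ * t)) * -μ = 0 by ring,
      zero_smul] at h3
  have hconst := is_const_of_deriv_eq_zero (fun t => (hd t).differentiableAt)
    (fun t => (hd t).deriv) t 0
  simp only [h0, mul_zero, neg_zero, Real.exp_zero, one_smul, one_apply_eq_self]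
    at hconst
  nth_rewrite 2 [← hconst]
  rw [smul_smul, ← Real.exp_add, add_neg_cancel, Real.exp_zero, one_smul]

lemma exists_eigenbasis [FiniteDimensional ℝ W] {A : Module.End ℝ W}
    (hA : ⨆ μ : ℝ, A.eigenspace μ = ⊤) :
    ∃ (d : ℕ) (b : Module.Basis (Fin d) ℝ W) (μ : Fin d → ℝ), ∀ i, A (b i) = μ i • b i := by
  have hs : Submodule.span ℝ {x : W | ∃ μ : ℝ, A x = μ • x} = ⊤ := by
    rw [eq_top_iff, ← hA]
    exact iSup_le fun μ x hx => Submodule.subset_span ⟨μ, Module.End.mem_eigenspace_iff.mp hx⟩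
  obtain ⟨f, hf, hspan, hli⟩ :=
    Submodule.exists_fun_fin_finrank_span_eq ℝ {x : W | ∃ μ : ℝ, A x = μ • x}
  choose μ hμ using hf
  exact ⟨_, Module.Basis.mk hli (by rw [hspan, hs]), μ, fun i => by simpa using hμ i⟩

/-- The flow `Φ` acts on the basis `b` by the real characters `t ↦ exp (μ i * t)`. -/
def ActsDiagonally {ι : Type*} (Φ : ℝ → Module.End ℝ W) (b : Module.Basis ι ℝ W) (μ : ι → ℝ) :
    Prop :=
  ∀ t i, Φ t (b i) = Real.exp (μ i * t) • b i

/-- The forward orbit of `x` under `Φ` is bounded. -/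
def ForwardBounded (Φ : ℝ → Module.End ℝ W) (x : W) : Prop :=
  ∃ B : ℝ, ∀ t, 0 ≤ t → ‖Φ t x‖ ≤ B

namespace ActsDiagonally

variable {ι : Type*} [Fintype ι] {Φ : ℝ → Module.End ℝ W} {b : Module.Basis ι ℝ W} {μ : ι → ℝ}

lemma repr_apply (h : ActsDiagonally Φ b μ) (t : ℝ) (x : W) (i : ι) :
    b.repr (Φ t x) i = Real.exp (μ i * t) * b.repr x i := by
  classical
  conv_lhs => rw [← b.sum_repr x]
  simp only [map_sum, map_smul, h t, Module.Basis.repr_self]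
  simp [Finsupp.finsetSum_apply, Finsupp.single_apply, mul_comm]

end ActsDiagonally

lemma exists_abs_repr_le [FiniteDimensional ℝ W] {ι : Type*} [Fintype ι]
    (b : Module.Basis ι ℝ W) :
    ∃ K : ℝ, 0 < K ∧ ∀ x i, |b.repr x i| ≤ K * ‖x‖ := by
  refine ⟨‖(b.equivFunL : W →L[ℝ] ι → ℝ)‖ + 1, by positivity, fun x i => ?_⟩
  have h1 := norm_le_pi_norm (b.equivFunL x) i
  have h2 := (b.equivFunL : W →L[ℝ] ι → ℝ).le_opNorm x
  simp only [ContinuousLinearEquiv.coe_coe, Real.norm_eq_abs] at h1 h2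
  have h3 : b.equivFunL x i = b.repr x i := by simp [Module.Basis.equivFunL]
  rw [h3] at h1
  nlinarith [norm_nonneg x]

namespace ActsDiagonally

variable [FiniteDimensional ℝ W] {ι : Type*} [Fintype ι] {Φ : ℝ → Module.End ℝ W}
  {b : Module.Basis ι ℝ W} {μ : ι → ℝ}

lemma repr_eq_zero (h : ActsDiagonally Φ b μ) {x : W} (hx : ForwardBounded Φ x) {i : ι}
    (hi : 0 < μ i) : b.repr x i = 0 := by
  obtain ⟨K, hK, hKx⟩ := exists_abs_repr_le b
  obtain ⟨B, hB⟩ := hx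
  by_contra hne
  have hlim : Filter.Tendsto (fun t => Real.exp (μ i * t) * |b.repr x i|) Filter.atTop
      Filter.atTop :=
    (Real.tendsto_exp_atTop.comp (Filter.tendsto_id.const_mul_atTop hi)).atTop_mul_const
      (abs_pos.mpr hne)
  obtain ⟨t, ht, ht'⟩ := ((hlim.eventually_gt_atTop (K * B)).and
    (Filter.eventually_ge_atTop 0)).exists
  have h1 := hKx (Φ t x) i
  rw [h.repr_apply, abs_mul, Real.abs_exp] at h1
  nlinarith [hB t ht']

lemma exists_norm_le (h : ActsDiagonally Φ b μ) :
    ∃ K : ℝ, ∀ x, (∀ i, 0 < μ i → b.repr x i = 0) → ∀ t, 0 ≤ t → ‖Φ t x‖ ≤ K * ‖x‖ := by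
  obtain ⟨K, hK, hKx⟩ := exists_abs_repr_le b
  refine ⟨∑ i, K * ‖b i‖, fun x hx t ht => ?_⟩
  conv_lhs => rw [← b.sum_repr (Φ t x)]
  refine (norm_sum_le _ _).trans ?_
  rw [Finset.sum_mul]
  refine Finset.sum_le_sum fun i _ => ?_
  rw [norm_smul, h.repr_apply, Real.norm_eq_abs, abs_mul, Real.abs_exp]
  have h1 : Real.exp (μ i * t) * |b.repr x i| ≤ K * ‖x‖ := by
    by_cases hi : 0 < μ i
    · rw [hx i hi, abs_zero, mul_zero]; positivity
    · have : Real.exp (μ i * t) ≤ 1 :=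
        Real.exp_le_one_iff.mpr (mul_nonpos_of_nonpos_of_nonneg (not_lt.mp hi) ht)
      calc _ ≤ 1 * |b.repr x i| := by gcongr
        _ ≤ _ := by rw [one_mul]; exact hKx x i
  calc _ ≤ K * ‖x‖ * ‖b i‖ := by gcongr
    _ = _ := by ring

lemma forwardBounded (h : ActsDiagonally Φ b μ) {x : W} (hx : ∀ i, 0 < μ i → b.repr x i = 0) :
    ForwardBounded Φ x :=
  let ⟨K, hK⟩ := h.exists_norm_le
  ⟨K * ‖x‖, hK x hx⟩

lemma apply_eq_self (h : ActsDiagonally Φ b μ) {x : W} (hx : ForwardBounded Φ x)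
    (hx' : ForwardBounded (fun t => Φ (-t)) x) (t : ℝ) : Φ t x = x := by
  have h' : ActsDiagonally (fun t => Φ (-t)) b (fun i => -μ i) := fun t i => by
    simp only [h (-t) i]; ring_nf
  refine b.repr.injective (Finsupp.ext fun i => ?_)
  rw [h.repr_apply]
  rcases lt_trichotomy (μ i) 0 with hi | hi | hi
  · rw [h'.repr_eq_zero hx' (neg_pos.mpr hi), mul_zero]
  · simp [hi]
  · rw [h.repr_eq_zero hx hi, mul_zero]

end ActsDiagonally

/-- If the directions `e k` of a diagonal torus sum to zero, a vector whose forward orbit along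
each of them is bounded is fixed by all of them. -/
theorem fixed_of_forwardBounded [FiniteDimensional ℝ W] {T κ : Type*} [AddCommGroup T] [Module ℝ T]
    [Fintype κ] {Ψ : T → Module.End ℝ W} (h0 : Ψ 0 = 1) (hadd : ∀ x y, Ψ (x + y) = Ψ x * Ψ y)
    {e : κ → T} (he : ∑ k, e k = 0)
    (hdiag : ∀ k, ∃ (d : ℕ) (b : Module.Basis (Fin d) ℝ W) (μ : Fin d → ℝ),
      ActsDiagonally (fun t => Ψ (t • e k)) b μ)
    {x : W} (hx : ∀ k, ForwardBounded (fun t => Ψ (t • e k)) x) (k : κ) (t : ℝ) :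
    Ψ (t • e k) x = x := by
  classical
  have hbd : ∀ S : Finset κ, ForwardBounded (fun t => Ψ (t • ∑ k ∈ S, e k)) x := by
    intro S
    induction S using Finset.induction_on with
    | empty => exact ⟨‖x‖, fun t _ => by simp [h0]⟩
    | insert k S hk ih =>
      obtain ⟨B, hB⟩ := ih
      obtain ⟨d, b, μ, hb⟩ := hdiag k
      obtain ⟨K, hK⟩ := hb.exists_norm_le
      refine ⟨|K| * B, fun t ht => ?_⟩
      simp only [Finset.sum_insert hk, smul_add, hadd, Module.End.mul_apply]
      set P := Ψ (t • ∑ k ∈ S, e k) with hP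
      have hPx : ForwardBounded (fun t => Ψ (t • e k)) (P x) := by
        obtain ⟨B', hB'⟩ := hx k
        refine ⟨‖LinearMap.toContinuousLinearMap P‖ * B', fun s hs => ?_⟩
        have hc : Ψ (s • e k) * P = P * Ψ (s • e k) := by rw [hP, ← hadd, ← hadd, add_comm]
        rw [← Module.End.mul_apply, hc, Module.End.mul_apply]
        exact ((LinearMap.toContinuousLinearMap P).le_opNorm _).trans (by gcongr; exact hB' s hs)
      calc _ ≤ K * ‖P x‖ := hK _ (fun i hi => hb.repr_eq_zero hPx hi) t ht
        _ ≤ |K| * ‖P x‖ := by gcongr; exact le_abs_self K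
        _ ≤ |K| * B := by gcongr; exact hB t ht
  obtain ⟨d, b, μ, hb⟩ := hdiag k
  refine hb.apply_eq_self (hx k) ?_ t
  obtain ⟨B, hB⟩ := hbd (Finset.univ.erase k)
  refine ⟨B, fun s hs => ?_⟩
  have h1 : ∑ l ∈ Finset.univ.erase k, e l = -e k := by
    rw [← Finset.add_sum_erase _ _ (Finset.mem_univ k)] at he
    exact eq_neg_of_add_eq_zero_right he
  simpa [h1] using hB s hs

end OneParameter

section Torus

open Matrix.SpecialLinearGroup

variable {ι : Type*} [Fintype ι] [DecidableEq ι]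

/-- The Lie algebra of the diagonal torus of `SL(ι, ℝ)`. -/
def traceFree (ι : Type*) [Fintype ι] : Submodule ℝ (ι → ℝ) where
  carrier := {e | ∑ k, e k = 0}
  add_mem' := fun {x y} hx hy => by
    simp only [Set.mem_ofPred_eq] at hx hy
    simp [Finset.sum_add_distrib, hx, hy]
  zero_mem' := by simp
  smul_mem' := fun c x hx => by
    simp only [Set.mem_ofPred_eq] at hx
    simp [← Finset.mul_sum, hx]

/-- The exponential map of the diagonal torus. -/
def expDiag (e : traceFree ι) : SpecialLinearGroup ι ℝ :=
  ⟨diagonal fun k => Real.exp (e.1 k), by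
    rw [det_diagonal, ← Real.exp_sum, show ∑ k, e.1 k = 0 from e.2, Real.exp_zero]⟩

lemma coe_expDiag (e : traceFree ι) :
    (expDiag e : Matrix ι ι ℝ) = diagonal fun k => Real.exp (e.1 k) := rfl

lemma expDiag_zero : expDiag (0 : traceFree ι) = 1 := by
  ext i j
  simp [coe_expDiag, diagonal_apply, one_apply]

lemma expDiag_add (e f : traceFree ι) : expDiag (e + f) = expDiag e * expDiag f := by
  refine Subtype.ext ?_
  simp [coe_expDiag, diagonal_mul_diagonal, Real.exp_add]

lemma expDiag_neg (e : traceFree ι) : expDiag (-e) = (expDiag e)⁻¹ := by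
  rw [eq_inv_iff_mul_eq_one, ← expDiag_add, neg_add_cancel, expDiag_zero]

lemma expDiag_mul_transvection {i j : ι} (hij : i ≠ j) (e : traceFree ι) (c : ℝ) :
    expDiag e * transvection hij c =
      transvection hij (Real.exp (e.1 i - e.1 j) * c) * expDiag e := by
  refine Subtype.ext ?_
  simp only [Matrix.SpecialLinearGroup.coe_mul, coe_expDiag, transvection_coe, mul_add, add_mul,
    mul_one, one_mul, add_right_inj]
  ext k l
  simp only [diagonal_mul, mul_diagonal, single_apply]
  split_ifs with h
  · obtain ⟨rfl, rfl⟩ := h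
    rw [mul_right_comm, ← Real.exp_add, sub_add_cancel]
  · simp

/-- The coroot `e i - e j`. -/
def coroot (i j : ι) : traceFree ι :=
  ⟨Pi.single i 1 - Pi.single j 1, by
    simp [traceFree, Finset.sum_sub_distrib]⟩

lemma transvection_mul_transvection_swap {i j : ι} (hij : i ≠ j) {x y : ℝ} (h : 1 + x * y ≠ 0) :
    transvection hij x * transvection hij.symm y =
      transvection hij.symm (y / (1 + x * y)) * diag2n hij (1 + x * y) h *
        transvection hij (x / (1 + x * y)) := by
  refine Subtype.ext ?_
  have hdiag : (diag2n hij (1 + x * y) h : Matrix ι ι ℝ) =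
      1 + (single i i (x * y) + single j j ((1 + x * y)⁻¹ - 1)) := by
    rw [diag2n_coe]
    ext k l
    simp only [diagonal_apply, Matrix.add_apply, one_apply, single_apply]
    grind
  simp only [Matrix.SpecialLinearGroup.coe_mul, hdiag, transvection_coe, mul_add, add_mul,
    mul_one, one_mul, add_zero, single_mul_single_same, single_mul_single_of_ne _ _ _ _ hij,
    single_mul_single_of_ne _ _ _ _ hij.symm]
  simp only [div_eq_mul_inv]
  have hw := mul_inv_cancel₀ h
  generalize (1 + x * y)⁻¹ = w at hw
  have h1 : single i j x = single i j (x * w) + single i j (x * y * (x * w)) := by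
    rw [← single_add]; congr 1; linear_combination -x * hw
  have h2 : single j i y = single j i (y * w) + single j i (y * w * (x * y)) := by
    rw [← single_add]; congr 1; linear_combination -y * hw
  have h3 : single j j (w - 1) + single j j (y * w * (x * w)) +
      single j j (y * w * (x * y) * (x * w)) = 0 := by
    rw [← single_add, ← single_add, ← single_zero j j]
    congr 1
    linear_combination (x * y * w + 1) * hw
  rw [← sub_eq_zero, h1, h2]
  refine Eq.trans ?_ (neg_eq_zero.mpr h3)
  abel

lemma diag2n_eq_expDiag {i j : ι} (hij : i ≠ j) {c : ℝ} (hc : 0 < c) :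
    diag2n hij c hc.ne' = expDiag (Real.log c • coroot i j) := by
  refine Subtype.ext ?_
  rw [diag2n_coe, coe_expDiag]
  congr 1
  ext k
  by_cases h1 : k = i
  · subst h1
    simp [coroot, hij, Real.exp_log hc]
  · by_cases h2 : k = j
    · subst h2
      simp [coroot, h1, Real.exp_neg, Real.exp_log hc]
    · simp [coroot, h1, h2]

/-- The diagonal direction with `i`-th coordinate `card ι - 1` and all other coordinates `-1`. -/
def expandDir (i : ι) : traceFree ι := ∑ j, coroot i j

lemma expandDir_apply (i k : ι) :
    (expandDir i).1 k = (if k = i then (Fintype.card ι : ℝ) else 0) - 1 := by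
  simp [expandDir, coroot, Finset.sum_apply, Pi.single_apply]

lemma sum_expandDir : ∑ i, expandDir (ι := ι) i = 0 := by
  refine Subtype.ext (funext fun k => ?_)
  rw [Submodule.coe_sum, Finset.sum_apply]
  simp [expandDir_apply]

lemma aSL_eq_expDiag (m : ℕ) (t : ℝ) : aSL m t = expDiag (t • expandDir 0) := by
  refine Subtype.ext ?_
  rw [coe_expDiag]
  simp only [aSL, aMat]
  congr 1
  ext k
  refine Fin.cases ?_ (fun k => ?_) k
  · simp [expandDir_apply, mul_comm]
  · simp [expandDir_apply]

/-- A subgroup of `SL(ι, ℝ)` containing all transvections is everything. -/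
lemma eq_top_of_transvection_mem [Nontrivial ι] {S : Subgroup (SpecialLinearGroup ι ℝ)}
    (h : ∀ (i j : ι) (hij : i ≠ j) (c : ℝ), transvection hij c ∈ S) : S = ⊤ := by
  refine eq_top_iff.mpr fun g _ => ?_
  refine diagonal_transvection_induction' (· ∈ S) g (fun i j hij c hc => ?_) h
    (fun _ _ => S.mul_mem)
  have h1 : 1 + (c - 1) * 1 ≠ 0 := by simpa using hc
  have h2 := transvection_mul_transvection_swap hij h1
  have h3 : diag2n hij c hc = diag2n hij (1 + (c - 1) * 1) h1 := by congr 1; ring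
  rw [← mul_inv_eq_iff_eq_mul, ← inv_mul_eq_iff_eq_mul] at h2
  rw [h3, ← h2]
  exact S.mul_mem (S.inv_mem (h _ _ _ _))
    (S.mul_mem (S.mul_mem (h _ _ _ _) (h _ _ _ _)) (S.inv_mem (h _ _ _ _)))

end Torus

section Generators

variable {𝔸 : Type*} [NormedRing 𝔸] [NormedAlgebra ℝ 𝔸]

lemma generator_relation_of_conj {D U : ℝ → 𝔸} {H E : 𝔸} {κ : ℝ} (hD0 : D 0 = 1)
    (hD : HasDerivAt D H 0) (hU : HasDerivAt U E 0)
    (hconj : ∀ t x, D t * U x = U (Real.exp (κ * t) * x) * D t) : H * E = E * H + κ • E := by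
  have h1 : ∀ t, D t * E = Real.exp (κ * t) • (E * D t) := by
    intro t
    have hl : HasDerivAt (fun x => D t * U x) (D t * E) 0 := hU.const_mul _
    have hs : HasDerivAt (fun x => Real.exp (κ * t) * x) (Real.exp (κ * t)) 0 := by
      simpa using (hasDerivAt_id (0 : ℝ)).const_mul (Real.exp (κ * t))
    have hr : HasDerivAt (fun x => U (Real.exp (κ * t) * x) * D t)
        ((Real.exp (κ * t) • E) * D t) 0 :=
      (HasDerivAt.scomp 0 (by simpa using hU) hs).mul_const _
    simp only [hconj] at hl
    rw [hl.unique hr, smul_mul_assoc]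
  have hl : HasDerivAt (fun t => D t * E) (H * E) 0 := hD.mul_const _
  have he : HasDerivAt (fun t : ℝ => Real.exp (κ * t)) κ 0 := by
    simpa using ((hasDerivAt_id (0 : ℝ)).const_mul κ).exp
  have hr := he.smul (hD.const_mul E)
  simp only [h1] at hl
  have h2 := hl.unique hr
  simpa [hD0] using h2

lemma generator_relation_of_bruhat {U L D : ℝ → 𝔸} {E F H : 𝔸}
    (hU0 : U 0 = 1) (hL0 : L 0 = 1) (hD0 : D 0 = 1)
    (hUadd : ∀ s t, U (s + t) = U s * U t)
    (hU : HasDerivAt U E 0) (hL : HasDerivAt L F 0) (hD : HasDerivAt D H 0)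
    (hrel : ∀ x y, 0 < 1 + x * y →
      U x * L y = L (y / (1 + x * y)) * D (Real.log (1 + x * y)) * U (x / (1 + x * y))) :
    E * F = F * E + H := by
  have h1 : ∀ x, U x * F = F * U x + x • (H * U x) - (x ^ 2) • (U x * E) := by
    intro x
    have hs : HasDerivAt (fun y => 1 + x * y) x 0 := by
      simpa using ((hasDerivAt_id (0 : ℝ)).const_mul x).const_add 1
    have hne : 1 + x * 0 ≠ 0 := by simp
    have hl : HasDerivAt (fun y => U x * L y) (U x * F) 0 := hL.const_mul _
    have hq1 : HasDerivAt (fun y => y / (1 + x * y)) 1 0 := by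
      have h := HasDerivAt.fun_div (hasDerivAt_id' (0 : ℝ)) hs hne
      simpa using h
    have hq2 : HasDerivAt (fun y => Real.log (1 + x * y)) x 0 := by
      simpa using hs.log hne
    have hq3 : HasDerivAt (fun y => x / (1 + x * y)) (-x ^ 2) 0 := by
      have h := HasDerivAt.fun_div (hasDerivAt_const (0 : ℝ) x) hs hne
      simpa [sq] using h
    have hr1 : HasDerivAt (fun y => L (y / (1 + x * y))) ((1 : ℝ) • F) 0 :=
      HasDerivAt.scomp 0 (by simpa using hL) hq1
    have hr2 : HasDerivAt (fun y => D (Real.log (1 + x * y))) (x • H) 0 :=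
      HasDerivAt.scomp 0 (by simpa using hD) hq2
    have hr3 : HasDerivAt (fun y => U (x / (1 + x * y))) ((-x ^ 2) • (U x * E)) 0 :=
      HasDerivAt.scomp 0 (by simpa using hasDerivAt_of_hom hUadd hU x) hq3
    have hr := (hr1.mul hr2).mul hr3
    have hev : (fun y => U x * L y) =ᶠ[nhds 0] fun y =>
        L (y / (1 + x * y)) * D (Real.log (1 + x * y)) * U (x / (1 + x * y)) := by
      have hcont : ContinuousAt (fun y => 1 + x * y) 0 := hs.continuousAt
      filter_upwards [hcont.eventually_mem (Ioi_mem_nhds (show (0 : ℝ) < 1 + x * 0 by simp))]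
        with y hy using hrel x y hy
    have h2 := (hl.congr_of_eventuallyEq hev.symm).unique hr
    simpa [hL0, hD0, sub_eq_add_neg, add_mul] using h2
  have hl : HasDerivAt (fun x => U x * F) (E * F) 0 := hU.mul_const _
  have hr := ((hU.const_mul F).add ((hasDerivAt_id (0 : ℝ)).smul (hU.const_mul H))).sub
    (((hasDerivAt_id (0 : ℝ)).pow 2).smul (hU.mul_const E))
  simp only [h1] at hl
  have h2 := hl.unique hr
  simpa [hU0] using h2

end Generators

section Representation

open Matrix.SpecialLinearGroup

variable {m : ℕ} {W : Type*} [NormedAddCommGroup W] [NormedSpace ℝ W] [FiniteDimensional ℝ W]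

/-- A representation of `SL(m + 1, ℝ)`, with values in bounded operators. -/
def clmRep (ρ : SpecialLinearGroup (Fin (m + 1)) ℝ →* Module.End ℝ W) :
    SpecialLinearGroup (Fin (m + 1)) ℝ →* (W →L[ℝ] W) where
  toFun g := LinearMap.toContinuousLinearMap (ρ g)
  map_one' := by ext; simp
  map_mul' g h := by ext; simp

variable {ρ : SpecialLinearGroup (Fin (m + 1)) ℝ →* Module.End ℝ W}

@[simp]
lemma clmRep_apply (g : SpecialLinearGroup (Fin (m + 1)) ℝ) (x : W) : clmRep ρ g x = ρ g x := rfl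

lemma continuous_clmRep (hcont : ∀ v : W, Continuous fun g => ρ g v) :
    Continuous (clmRep ρ) :=
  continuous_clm_apply.mpr hcont

lemma continuous_transvection {i j : Fin (m + 1)} (hij : i ≠ j) :
    Continuous fun x : ℝ => transvection hij x := by
  refine continuous_induced_rng.mpr ?_
  refine continuous_matrix fun k l => ?_
  simp only [Function.comp_def, transvection_coe, Matrix.add_apply, single_apply]
  split_ifs <;> fun_prop

lemma continuous_expDiag_smul (e : traceFree (Fin (m + 1))) :
    Continuous fun t : ℝ => expDiag (t • e) := by
  refine continuous_induced_rng.mpr (Continuous.matrix_diagonal ?_)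
  exact continuous_pi fun k => by simp only [Submodule.coe_smul, Pi.smul_apply]; fun_prop

/-- The direction `e` acts through `ρ` with a real-diagonalizable generator. -/
def DiagonalizableDir (ρ : SpecialLinearGroup (Fin (m + 1)) ℝ →* Module.End ℝ W)
    (e : traceFree (Fin (m + 1))) : Prop :=
  ∃ A : W →L[ℝ] W, HasDerivAt (fun t : ℝ => clmRep ρ (expDiag (t • e))) A 0 ∧
    ⨆ μ : ℝ, Module.End.eigenspace (A : Module.End ℝ W) μ = ⊤

lemma diagonalizableDir_coroot (hcont : ∀ v : W, Continuous fun g => ρ g v) {i j : Fin (m + 1)}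
    (hij : i ≠ j) : DiagonalizableDir ρ (coroot i j) := by
  set U : ℝ → W →L[ℝ] W := fun x => clmRep ρ (transvection hij x) with hU
  set L : ℝ → W →L[ℝ] W := fun x => clmRep ρ (transvection hij.symm x) with hL
  set D : ℝ → W →L[ℝ] W := fun t => clmRep ρ (expDiag (t • coroot i j)) with hD
  have hR := continuous_clmRep hcont
  have hU0 : U 0 = 1 := by simp [hU, transvection_coeff_zero]
  have hL0 : L 0 = 1 := by simp [hL, transvection_coeff_zero]
  have hD0 : D 0 = 1 := by simp [hD, expDiag_zero]
  have hUadd : ∀ s t, U (s + t) = U s * U t := by simp [hU, transvection_add]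
  have hLadd : ∀ s t, L (s + t) = L s * L t := by simp [hL, transvection_add]
  have hDadd : ∀ s t, D (s + t) = D s * D t := by simp [hD, add_smul, expDiag_add]
  obtain ⟨E, hE⟩ : ∃ A, HasDerivAt U A 0 := exists_hasDerivAt_of_continuous_hom
    (hR.comp (continuous_transvection hij)) hU0 hUadd
  obtain ⟨F, hF⟩ : ∃ A, HasDerivAt L A 0 := exists_hasDerivAt_of_continuous_hom
    (hR.comp (continuous_transvection hij.symm)) hL0 hLadd
  obtain ⟨H, hH⟩ : ∃ A, HasDerivAt D A 0 := exists_hasDerivAt_of_continuous_hom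
    (hR.comp (continuous_expDiag_smul (coroot i j))) hD0 hDadd
  have hi : (coroot i j).1 i = 1 := by simp [coroot, hij]
  have hj : (coroot i j).1 j = -1 := by simp [coroot, hij.symm]
  have hHE : H * E = E * H + (2 : ℝ) • E := by
    refine generator_relation_of_conj hD0 hH hE fun t x => ?_
    have h := congr(clmRep ρ $(expDiag_mul_transvection hij (t • coroot i j) x))
    rw [map_mul, map_mul, Submodule.coe_smul, Pi.smul_apply, Pi.smul_apply, hi, hj] at h
    refine h.trans ?_
    simp only [hD, hU, smul_eq_mul]
    ring_nf
  have hHF : H * F = F * H + (-2 : ℝ) • F := by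
    refine generator_relation_of_conj hD0 hH hF fun t x => ?_
    have h := congr(clmRep ρ $(expDiag_mul_transvection hij.symm (t • coroot i j) x))
    rw [map_mul, map_mul, Submodule.coe_smul, Pi.smul_apply, Pi.smul_apply, hi, hj] at h
    refine h.trans ?_
    simp only [hD, hL, smul_eq_mul]
    ring_nf
  have hEF : E * F = F * E + H := by
    refine generator_relation_of_bruhat hU0 hL0 hD0 hUadd hE hF hH fun x y hxy => ?_
    have h := congr(clmRep ρ $(transvection_mul_transvection_swap hij hxy.ne'))
    rw [diag2n_eq_expDiag hij hxy, map_mul, map_mul, map_mul] at h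
    exact h
  refine ⟨H, hH, slTwo_iSup_eigenspace_eq_top (E := (E : Module.End ℝ W))
    (F := (F : Module.End ℝ W)) (fun x => ?_) (fun x => ?_) (fun x => ?_)⟩
  · simpa using congr($hHE x)
  · simpa [sub_eq_add_neg] using congr($hHF x)
  · simpa using congr($hEF x)

lemma DiagonalizableDir.add {e f : traceFree (Fin (m + 1))} (he : DiagonalizableDir ρ e)
    (hf : DiagonalizableDir ρ f) : DiagonalizableDir ρ (e + f) := by
  obtain ⟨A, hA, hAtop⟩ := he
  obtain ⟨B, hB, hBtop⟩ := hf
  refine ⟨A + B, ?_, ?_⟩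
  · have h := hA.fun_mul hB
    simpa [smul_add, expDiag_add, expDiag_zero] using h
  have hcomm : A * B = B * A := by
    have h := generator_relation_of_conj (κ := 0) (by simp [expDiag_zero]) hA hB fun t x => by
      rw [zero_mul, Real.exp_zero, one_mul, ← map_mul, ← map_mul, ← expDiag_add, ← expDiag_add,
        add_comm (t • e)]
    simpa using h
  have hinv : ∀ μ : ℝ, ∀ x ∈ Module.End.eigenspace (A : Module.End ℝ W) μ,
      (B : Module.End ℝ W) x ∈ Module.End.eigenspace (A : Module.End ℝ W) μ := by
    intro μ x hx
    rw [Module.End.mem_eigenspace_iff] at hx ⊢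
    have h : A (B x) = B (A x) := congr($hcomm x)
    simp only [ContinuousLinearMap.coe_coe] at hx ⊢
    rw [h, hx, map_smul]
  rw [eq_top_iff, ← hAtop]
  refine iSup_le fun μ => ?_
  rw [Submodule.eq_iSup_inf_genEigenspace 1 (hinv μ) hBtop]
  refine iSup_le fun ν x hx => Submodule.mem_iSup_of_mem (μ + ν) ?_
  have h1 := Module.End.mem_eigenspace_iff.mp hx.1
  have h2 := Module.End.mem_eigenspace_iff.mp hx.2
  rw [Module.End.mem_eigenspace_iff]
  simp only [ContinuousLinearMap.coe_coe] at h1 h2 ⊢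
  rw [_root_.add_apply, h1, h2, add_smul]

lemma diagonalizableDir_expandDir (hcont : ∀ v : W, Continuous fun g => ρ g v)
    (i : Fin (m + 1)) : DiagonalizableDir ρ (expandDir i) := by
  have h0 : DiagonalizableDir ρ 0 := by
    refine ⟨0, by simpa using hasDerivAt_const (0 : ℝ) (clmRep ρ (expDiag 0)), ?_⟩
    refine eq_top_iff.mpr (le_trans ?_ (le_iSup _ 0))
    intro x _
    simp
  refine Finset.sum_induction _ (DiagonalizableDir ρ) (fun _ _ => .add) h0 fun j _ => ?_
  rcases eq_or_ne i j with rfl | hij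
  · rwa [show coroot i i = 0 from Subtype.ext (sub_self _)]
  · exact diagonalizableDir_coroot hcont hij

lemma exists_actsDiagonally (hcont : ∀ v : W, Continuous fun g => ρ g v) (i : Fin (m + 1)) :
    ∃ (d : ℕ) (b : Module.Basis (Fin d) ℝ W) (μ : Fin d → ℝ),
      ActsDiagonally (fun t => ρ (expDiag (t • expandDir i))) b μ := by
  obtain ⟨A, hA, htop⟩ := diagonalizableDir_expandDir hcont i
  obtain ⟨d, b, μ, hb⟩ := exists_eigenbasis htop
  refine ⟨d, b, μ, fun t k => ?_⟩
  exact apply_eigenvector_of_hom (by simp [expDiag_zero])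
    (fun s t => by simp [add_smul, expDiag_add]) hA (hb k) t

end Representation

section Boundedness

variable {m : ℕ} {W : Type*} [NormedAddCommGroup W] [NormedSpace ℝ W] [FiniteDimensional ℝ W]
  {ρ : SpecialLinearGroup (Fin (m + 1)) ℝ →* Module.End ℝ W}

lemma isCompact_setOf_abs_entry_le (m : ℕ) (B : ℝ) :
    IsCompact {M : SpecialLinearGroup (Fin (m + 1)) ℝ | ∀ k l, |M.1 k l| ≤ B} := by
  have hind : @Topology.IsInducing (SpecialLinearGroup (Fin (m + 1)) ℝ)
      (Matrix (Fin (m + 1)) (Fin (m + 1)) ℝ) (SLtop m) _ Subtype.val := ⟨rfl⟩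
  rw [hind.isCompact_iff]
  have hbox : IsCompact {M : Matrix (Fin (m + 1)) (Fin (m + 1)) ℝ | ∀ k l, |M k l| ≤ B} := by
    have h := isCompact_univ_pi fun _ : Fin (m + 1) => isCompact_univ_pi fun _ : Fin (m + 1) =>
      isCompact_Icc (a := -B) (b := B)
    refine (congrArg IsCompact (Set.ext fun M => ?_)).mpr h
    simp only [Set.mem_ofPred_eq, abs_le]
    exact ⟨fun h k _ l _ => h k l, fun h k l => h k trivial l trivial⟩
  have hdet : IsClosed {M : Matrix (Fin (m + 1)) (Fin (m + 1)) ℝ | M.det = 1} :=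
    isClosed_eq (continuous_id.matrix_det) continuous_const
  refine (congrArg IsCompact (Set.ext fun M => ?_)).mpr (hbox.inter_right hdet)
  constructor
  · rintro ⟨g, hg, rfl⟩
    exact ⟨hg, g.2⟩
  · rintro ⟨h1, h2⟩
    exact ⟨⟨M, h2⟩, h1, rfl⟩

lemma exists_norm_apply_le (hcont : ∀ v : W, Continuous fun g => ρ g v) (B : ℝ) :
    ∃ K : ℝ, ∀ M : SpecialLinearGroup (Fin (m + 1)) ℝ, (∀ k l, |M.1 k l| ≤ B) →
      ∀ v, ‖ρ M v‖ ≤ K * ‖v‖ := by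
  obtain ⟨K, hK⟩ := (isCompact_setOf_abs_entry_le m B).exists_bound_of_continuousOn
    (continuous_clmRep hcont).continuousOn
  exact ⟨K, fun M hM v => ((clmRep ρ M).le_opNorm v).trans (by gcongr; exact hK M hM)⟩

lemma forwardBounded_expandDir (hcont : ∀ v : W, Continuous fun g => ρ g v)
    {g : SpecialLinearGroup (Fin (m + 1)) ℝ} {i : Fin (m + 1)} {c : ℝ} {ξ : Fin m → ℝ}
    (hrow : ∀ k, g.1 i k = c * uMat m ξ 0 k) {v : W}
    (hv : ForwardBounded (fun t => ρ (aSL m t * uSL m ξ)) v) :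
    ForwardBounded (fun t => ρ (expDiag (t • expandDir i))) (ρ g v) := by
  set q := g * (uSL m ξ)⁻¹ with hq
  have hqi : ∀ l, q.1 i l = c * (1 : Matrix (Fin (m + 1)) (Fin (m + 1)) ℝ) 0 l := by
    intro l
    have h1 : (uSL m ξ).1 * ((uSL m ξ)⁻¹).1 = 1 := congrArg Subtype.val (mul_inv_cancel (uSL m ξ))
    rw [← h1, Matrix.mul_apply, Finset.mul_sum]
    refine (Matrix.mul_apply ..).trans (Finset.sum_congr rfl fun k _ => ?_)
    rw [hrow, mul_assoc]
    rfl
  obtain ⟨K, hK⟩ := exists_norm_apply_le hcont (∑ k, ∑ l, |q.1 k l|)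
  obtain ⟨B, hB⟩ := hv
  refine ⟨|K| * B, fun t ht => ?_⟩
  set P := expDiag (t • expandDir i) * q * expDiag (-(t • expandDir 0)) with hP
  have hPv : ρ (expDiag (t • expandDir i)) (ρ g v) = ρ P (ρ (aSL m t * uSL m ξ) v) := by
    rw [← Module.End.mul_apply, ← map_mul, ← Module.End.mul_apply, ← map_mul, hP, hq,
      expDiag_neg, aSL_eq_expDiag]
    congr 2
    group
  have hPentry : ∀ k l, |P.1 k l| ≤ ∑ k, ∑ l, |q.1 k l| := by
    intro k l
    have h1 : |P.1 k l| ≤ |q.1 k l| := by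
      have h2 : P.1 k l = Real.exp (t * (expandDir i).1 k) * q.1 k l *
          Real.exp (-(t * (expandDir 0).1 l)) := by
        have h3 : P.1 = (Matrix.diagonal fun k => Real.exp ((t • expandDir i).1 k)) * q.1 *
          Matrix.diagonal fun k => Real.exp ((-(t • expandDir 0)).1 k) := rfl
        rw [h3, mul_diagonal, diagonal_mul]
        rfl
      rw [h2, mul_right_comm, ← Real.exp_add, expandDir_apply, expandDir_apply, abs_mul,
        Real.abs_exp]
      by_cases h0 : k = i ∧ l ≠ 0
      · rw [h0.1, hqi, Matrix.one_apply_ne h0.2.symm]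
        simp
      · refine mul_le_of_le_one_left (abs_nonneg _) (Real.exp_le_one_iff.mpr ?_)
        have hle : (if k = i then (Fintype.card (Fin (m + 1)) : ℝ) else 0) ≤
            if l = 0 then (Fintype.card (Fin (m + 1)) : ℝ) else 0 := by
          split_ifs with h1 h2
          · exact le_rfl
          · exact absurd ⟨h1, h2⟩ h0
          · positivity
          · exact le_rfl
        nlinarith
    calc |P.1 k l| ≤ |q.1 k l| := h1
      _ ≤ ∑ l, |q.1 k l| :=
        Finset.single_le_sum (f := fun l => |q.1 k l|) (fun _ _ => abs_nonneg _)
          (Finset.mem_univ l)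
      _ ≤ _ := Finset.single_le_sum (f := fun k => ∑ l, |q.1 k l|)
          (fun _ _ => Finset.sum_nonneg fun _ _ => abs_nonneg _) (Finset.mem_univ k)
  simp only [hPv]
  calc _ ≤ K * ‖ρ (aSL m t * uSL m ξ) v‖ := hK P hPentry _
    _ ≤ |K| * ‖ρ (aSL m t * uSL m ξ) v‖ := by gcongr; exact le_abs_self K
    _ ≤ |K| * B := by gcongr; exact hB t ht

end Boundedness

section RowGeneration

open Matrix.SpecialLinearGroup

variable {ι : Type*} [Fintype ι] [DecidableEq ι]

/-- Every row of `g` is a multiple of an element of `R`. -/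
def RowsIn (R : Set (ι → ℝ)) (g : SpecialLinearGroup ι ℝ) : Prop :=
  ∀ i, ∃ r ∈ R, ∃ c : ℝ, ∀ k, g.1 i k = c * r k

/-- `S` contains the root subgroup of `(i, j)`. -/
def HasRoot (S : Subgroup (SpecialLinearGroup ι ℝ)) (i j : ι) : Prop :=
  ∀ (hij : i ≠ j) (c : ℝ), transvection hij c ∈ S

lemma HasRoot.trans {S : Subgroup (SpecialLinearGroup ι ℝ)} {i j k : ι} (h₁ : HasRoot S i j)
    (h₂ : HasRoot S j k) : HasRoot S i k := by
  intro hik c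
  rcases eq_or_ne i j with rfl | hij
  · exact h₂ hik c
  rcases eq_or_ne j k with rfl | hjk
  · exact h₁ hik c
  have h : transvection hij c * transvection hjk 1 =
      transvection hjk 1 * transvection hij c * transvection hik c := by
    refine Subtype.ext ?_
    simp [Matrix.SpecialLinearGroup.coe_mul, transvection_coe, mul_add, add_mul, hij.symm,
      hik.symm]
    abel
  rw [← inv_mul_eq_iff_eq_mul] at h
  rw [← h]
  exact S.mul_mem (S.inv_mem (S.mul_mem (h₂ _ _) (h₁ _ _))) (S.mul_mem (h₁ _ _) (h₂ _ _))

lemma hasRoot_of_transvection_mem {S : Subgroup (SpecialLinearGroup ι ℝ)}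
    (hD : ∀ (i : ι) (t : ℝ), expDiag (t • expandDir i) ∈ S) {i j : ι} (hij : i ≠ j) {x : ℝ}
    (hx : x ≠ 0) (h : SpecialLinearGroup.transvection hij x ∈ S) : HasRoot S i j := by
  have hcard : (Fintype.card ι : ℝ) ≠ 0 := by
    have : Nonempty ι := ⟨i⟩
    exact_mod_cast Fintype.card_ne_zero
  have hpos : ∀ c, 0 < c / x → transvection hij c ∈ S := by
    intro c hc
    set s : ℝ := Real.log (c / x) / Fintype.card ι with hs
    have h1 := expDiag_mul_transvection hij (s • expandDir i) x
    rw [← mul_inv_eq_iff_eq_mul] at h1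
    have h2 : Real.exp ((s • expandDir i : traceFree ι).1 i -
        (s • expandDir i : traceFree ι).1 j) * x = c := by
      rw [Submodule.coe_smul, Pi.smul_apply, Pi.smul_apply, expandDir_apply, expandDir_apply,
        if_pos rfl, if_neg hij.symm, smul_eq_mul, smul_eq_mul, hs]
      rw [← mul_sub, sub_sub_sub_cancel_right, sub_zero, div_mul_cancel₀ _ hcard,
        Real.exp_log hc, div_mul_cancel₀ _ hx]
    rw [← h2, ← h1]
    exact S.mul_mem (S.mul_mem (hD _ _) h) (S.inv_mem (hD _ _))
  intro hij c
  rcases lt_trichotomy (c / x) 0 with hc | hc | hc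
  · rw [← inv_inv (transvection hij c), transvection_inv]
    exact S.inv_mem (hpos _ (by rw [neg_div]; linarith))
  · rw [(div_eq_zero_iff.mp hc).resolve_right hx, transvection_coeff_zero]
    exact S.one_mem
  · exact hpos c hc

lemma hasRoot_of_mem {R : Set (ι → ℝ)} (h1 : RowsIn R 1)
    {S : Subgroup (SpecialLinearGroup ι ℝ)}
    (hS : ∀ g : SpecialLinearGroup ι ℝ, RowsIn R g →
      ∀ (i : ι) (t : ℝ), g⁻¹ * expDiag (t • expandDir i) * g ∈ S) {r : ι → ℝ}
    (hr : r ∈ R) {i j : ι} (hi : r i ≠ 0) (hj : r j ≠ 0) : HasRoot S i j := by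
  intro hij
  have hD : ∀ (i : ι) (t : ℝ), expDiag (t • expandDir i) ∈ S := fun i t => by
    simpa using hS 1 h1 i t
  set w : ι → ℝ := (r i)⁻¹ • r
  have hwi : w i = 1 := inv_mul_cancel₀ hi
  have hwj : w j ≠ 0 := mul_ne_zero (inv_ne_zero hi) hj
  let h : SpecialLinearGroup ι ℝ := ⟨Matrix.updateRow 1 i w, by
    rw [← cramer_transpose_apply, transpose_one, cramer_one]; simpa⟩
  have hh : RowsIn R h := by
    intro k
    rcases eq_or_ne k i with rfl | hk
    · exact ⟨r, hr, (r k)⁻¹, fun l => by simp [h, w]⟩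
    · obtain ⟨r', hr', c, hc⟩ := h1 k
      exact ⟨r', hr', c, fun l => by rw [← hc]; simp [h, hk]⟩
  set e : traceFree ι := (1 : ℝ) • expandDir j with he
  set x := w j * (Real.exp (e.1 i - e.1 j) - 1) with hx
  have hx0 : x ≠ 0 := by
    refine mul_ne_zero hwj (sub_ne_zero.mpr ?_)
    rw [Ne, Real.exp_eq_one_iff, he, one_smul, expandDir_apply, expandDir_apply, if_neg hij,
      if_pos rfl, zero_sub]
    have : Nonempty ι := ⟨i⟩
    have : (Fintype.card ι : ℝ) ≠ 0 := by exact_mod_cast Fintype.card_ne_zero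
    exact fun h => this (by linarith)
  have heq : ∀ k ≠ j, e.1 k = -1 := by
    intro k hk
    rw [he, one_smul, expandDir_apply, if_neg hk, zero_sub]
  have key : expDiag e * h = h * transvection hij x * expDiag e := by
    refine Subtype.ext (Matrix.ext fun k l => ?_)
    have hl : (expDiag e * h).1 k l = Real.exp (e.1 k) * h.1 k l :=
      Matrix.diagonal_mul ..
    have hr : (h * transvection hij x * expDiag e).1 k l =
        (h.1 * Matrix.transvection i j x) k l * Real.exp (e.1 l) :=
      Matrix.mul_diagonal ..
    rw [hl, hr]
    rcases eq_or_ne l j with rfl | hlj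
    · rw [mul_transvection_apply_same]
      rcases eq_or_ne k i with rfl | hk
      · have h2 : h.1 k l = w l := by simp [h]
        have h3 : h.1 k k = 1 := by simp [h, hwi]
        rw [h2, h3, hx, Real.exp_sub]
        field_simp
        ring
      · have h2 : h.1 k i = 0 := by simp [h, hk]
        rw [h2, mul_zero, add_zero]
        rcases eq_or_ne k l with rfl | hkl
        · exact mul_comm _ _
        · simp [h, hk, hkl]
    · rw [mul_transvection_apply_of_ne _ _ _ _ hlj, heq l hlj]
      rcases eq_or_ne k j with rfl | hkj
      · have h2 : h.1 k l = 0 := by simp [h, hij.symm, hlj.symm]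
        simp [h2]
      · rw [heq k hkj, mul_comm]
  refine hasRoot_of_transvection_mem hD hij hx0 ?_ hij
  rw [← mul_inv_eq_iff_eq_mul, mul_assoc] at key
  rw [← inv_mul_eq_iff_eq_mul] at key
  rw [← key, ← mul_assoc, ← mul_assoc]
  exact S.mul_mem (hS h hh j 1) (S.inv_mem (hD _ _))

lemma eq_top_of_rowsIn_one [Nontrivial ι] {R : Set (ι → ℝ)} (hconn : IsPreconnected R)
    (h0 : (0 : ι → ℝ) ∉ R) (h1 : RowsIn R 1) {S : Subgroup (SpecialLinearGroup ι ℝ)}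
    (hS : ∀ g : SpecialLinearGroup ι ℝ, RowsIn R g →
      ∀ (i : ι) (t : ℝ), g⁻¹ * expDiag (t • expandDir i) * g ∈ S) : S = ⊤ := by
  refine eq_top_of_transvection_mem fun i₀ j₀ => ?_
  by_contra hne
  let A : Set ι := {j | HasRoot S i₀ j ∧ HasRoot S j i₀}
  have hi₀ : i₀ ∈ A := ⟨fun h => (h rfl).elim, fun h => (h rfl).elim⟩
  have hj₀ : j₀ ∉ A := fun h => hne h.1
  have hsep : ∀ r ∈ R, ∀ i j, r i ≠ 0 → r j ≠ 0 → i ∈ A → j ∈ A := fun r hr i j hi hj hA =>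
    ⟨hA.1.trans (hasRoot_of_mem h1 hS hr hi hj), (hasRoot_of_mem h1 hS hr hj hi).trans hA.2⟩
  have hclosed : ∀ B : Set ι, IsClosed {r : ι → ℝ | ∀ j ∈ B, r j = 0} := by
    intro B
    simp only [Set.ofPred_forall]
    exact isClosed_iInter fun j => isClosed_iInter fun _ =>
      isClosed_eq (continuous_apply j) continuous_const
  have hrow : ∀ i, ∃ r ∈ R, ∀ k ≠ i, r k = 0 := by
    intro i
    obtain ⟨r, hr, c, hc⟩ := h1 i
    have hci : c ≠ 0 := by
      rintro rfl
      simpa using hc i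
    refine ⟨r, hr, fun k hk => ?_⟩
    have h2 := hc k
    have h3 : (1 : SpecialLinearGroup ι ℝ).1 i k = 0 := Matrix.one_apply_ne hk.symm
    rw [h3] at h2
    exact (mul_eq_zero.mp h2.symm).resolve_left hci
  obtain ⟨r₁, hr₁, h₁⟩ := hrow i₀
  obtain ⟨r₂, hr₂, h₂⟩ := hrow j₀
  obtain ⟨r, hr, hrA, hrA'⟩ := isPreconnected_closed_iff.mp hconn _ _ (hclosed Aᶜ) (hclosed A)
    (fun r hr => by
      by_cases h : ∃ i ∈ A, r i ≠ 0
      · obtain ⟨i, hi, hri⟩ := h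
        exact .inl fun j hj => by_contra fun hrj => hj (hsep r hr i j hri hrj hi)
      · exact .inr fun j hj => by_contra fun hrj => h ⟨j, hj, hrj⟩)
    ⟨r₁, hr₁, fun j hj => h₁ j fun h => hj (h ▸ hi₀)⟩
    ⟨r₂, hr₂, fun j hj => h₂ j fun h => hj₀ (h ▸ hj)⟩
  refine h0 ?_
  have : r = 0 := funext fun j => (Classical.em (j ∈ A)).elim (hrA' j) (hrA j)
  exact this ▸ hr

lemma exists_rowsIn [Nonempty ι] {R : Set (ι → ℝ)} (hspan : Submodule.span ℝ R = ⊤) :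
    ∃ g, RowsIn R g := by
  obtain ⟨f, hf, -, hli⟩ := Submodule.exists_fun_fin_finrank_span_eq ℝ R
  have hcard : Module.finrank ℝ (Submodule.span ℝ R) = Fintype.card ι := by
    rw [hspan, finrank_top, Module.finrank_fintype_fun_eq_card]
  let σ : ι ≃ Fin (Module.finrank ℝ (Submodule.span ℝ R)) :=
    (Fintype.equivFin ι).trans (finCongr hcard.symm)
  let A : Matrix ι ι ℝ := Matrix.of fun i => f (σ i)
  have hA : A.det ≠ 0 := by
    have h : LinearIndependent ℝ A.row := hli.comp σ σ.injective
    have hu := Matrix.linearIndependent_rows_iff_isUnit.mp h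
    exact ((Matrix.isUnit_iff_isUnit_det _).mp hu).ne_zero
  let i₀ := Classical.arbitrary ι
  refine ⟨⟨A.updateRow i₀ (A.det⁻¹ • A i₀), ?_⟩, fun i => ⟨f (σ i), hf _, ?_⟩⟩
  · rw [det_updateRow_smul, updateRow_eq_self, inv_mul_cancel₀ hA]
  · rcases eq_or_ne i i₀ with rfl | hi
    · exact ⟨A.det⁻¹, fun k => by simp [A]⟩
    · exact ⟨1, fun k => by simp [A, hi]⟩

/-- A subgroup of `SL(ι, ℝ)` containing the conjugates of the expanding one-parameter groups by
all matrices with rows from a connected spanning set is the whole group. -/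
theorem eq_top_of_rowsIn [Nontrivial ι] {R : Set (ι → ℝ)} (hconn : IsPreconnected R)
    (h0 : (0 : ι → ℝ) ∉ R) (hspan : Submodule.span ℝ R = ⊤)
    {S : Subgroup (SpecialLinearGroup ι ℝ)}
    (hS : ∀ g : SpecialLinearGroup ι ℝ, RowsIn R g →
      ∀ (i : ι) (t : ℝ), g⁻¹ * expDiag (t • expandDir i) * g ∈ S) : S = ⊤ := by
  obtain ⟨g₀, hg₀⟩ := exists_rowsIn hspan
  have hinv : g₀.1 * (g₀⁻¹).1 = 1 := congrArg Subtype.val (mul_inv_cancel g₀)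
  have hinv' : (g₀⁻¹).1 * g₀.1 = 1 := congrArg Subtype.val (inv_mul_cancel g₀)
  set R' := (fun r => r ᵥ* (g₀⁻¹).1) '' R
  have htop : S.comap (MulAut.conj g₀⁻¹).toMonoidHom = ⊤ := by
    refine eq_top_of_rowsIn_one (R := R') (hconn.image _ (by fun_prop)) ?_ ?_ ?_
    · rintro ⟨r, hr, hr0⟩
      refine h0 ?_
      have : r = 0 := by
        rw [← vecMul_one r, ← hinv', ← vecMul_vecMul]
        simp only at hr0
        rw [hr0, zero_vecMul]
      exact this ▸ hr
    · intro i
      obtain ⟨r, hr, c, hc⟩ := hg₀ i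
      refine ⟨_, ⟨r, hr, rfl⟩, c, fun k => ?_⟩
      have h : (1 : Matrix ι ι ℝ) i = c • (r ᵥ* (g₀⁻¹).1) := by
        rw [← hinv, ← smul_vecMul, mul_apply_eq_vecMul]
        congr 1
        exact funext hc
      exact congrFun h k
    · intro h hh i t
      have hrows : RowsIn R (h * g₀) := by
        intro i
        obtain ⟨_, ⟨r, hr, rfl⟩, c, hc⟩ := hh i
        refine ⟨r, hr, c, fun k => ?_⟩
        have h2 : (h.1 * g₀.1) i = c • r := by
          rw [mul_apply_eq_vecMul, show h.1 i = c • (r ᵥ* (g₀⁻¹).1) from funext hc, smul_vecMul,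
            vecMul_vecMul, hinv', vecMul_one]
        exact congrFun h2 k
      have h3 := hS _ hrows i t
      rw [Subgroup.mem_comap]
      simpa [mul_assoc] using h3
  refine eq_top_iff.mpr fun g _ => ?_
  have h := htop.ge (Subgroup.mem_top (g₀ * g * g₀⁻¹))
  rw [Subgroup.mem_comap] at h
  simpa [mul_assoc] using h

end RowGeneration

section FirstRow

variable {m : ℕ}

lemma uMat_zero (ξ : Fin m → ℝ) : uMat m ξ 0 = Fin.cons 1 ξ := by
  refine funext (Fin.cases ?_ fun k => ?_)
  · simp [uMat, Xmat]
  · simp [uMat, Xmat, Matrix.one_apply_ne (Fin.succ_ne_zero k).symm]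

lemma continuous_uMat_zero : Continuous fun ξ : Fin m → ℝ => uMat m ξ 0 := by
  simp only [uMat_zero]
  exact continuous_const.finCons continuous_id

lemma continuous_uSL : Continuous (uSL m) := by
  refine continuous_induced_rng.mpr (continuous_matrix fun k l => ?_)
  rcases Fin.eq_zero_or_eq_succ k with rfl | ⟨k, rfl⟩
  · exact (continuous_apply l).comp continuous_uMat_zero
  · simp only [Function.comp_def, uSL, uMat, Matrix.add_apply, Xmat_apply_succ]
    fun_prop

lemma span_uMat_zero (hm : 1 ≤ m) {Ξ : Set (Fin m → ℝ)}
    (hflat : ∀ W : Submodule ℝ (Fin m → ℝ), (∀ x ∈ Ξ, ∀ y ∈ Ξ, x - y ∈ W) → W = ⊤) :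
    Submodule.span ℝ ((fun ξ => uMat m ξ 0) '' Ξ) = ⊤ := by
  obtain ⟨ξ, hξ⟩ : Ξ.Nonempty := by
    by_contra hne
    have : Nonempty (Fin m) := ⟨⟨0, hm⟩⟩
    exact bot_ne_top (hflat ⊥ fun x hx => (hne ⟨x, hx⟩).elim)
  set P := Submodule.span ℝ ((fun ξ => uMat m ξ 0) '' Ξ)
  have hmem : ∀ x ∈ Ξ, (Fin.cons 1 x : Fin (m + 1) → ℝ) ∈ P := fun x hx =>
    Submodule.subset_span ⟨x, hx, uMat_zero x⟩
  let J : (Fin m → ℝ) →ₗ[ℝ] Fin (m + 1) → ℝ :=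
    { toFun := fun w => Fin.cons 0 w
      map_add' := fun x y => funext (Fin.cases (by simp) (by simp))
      map_smul' := fun c x => funext (Fin.cases (by simp) (by simp)) }
  have hJ : P.comap J = ⊤ := by
    refine hflat _ fun x hx y hy => ?_
    have h : J (x - y) = (Fin.cons 1 x : Fin (m + 1) → ℝ) - Fin.cons 1 y :=
      funext (Fin.cases (by simp [J]) (by simp [J]))
    rw [Submodule.mem_comap, h]
    exact P.sub_mem (hmem x hx) (hmem y hy)
  refine eq_top_iff.mpr fun z _ => ?_
  have hz : z = z 0 • (Fin.cons 1 ξ : Fin (m + 1) → ℝ) + J (Fin.tail z - z 0 • ξ) :=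
    funext (Fin.cases (by simp [J]) (by simp [J, Fin.tail]))
  rw [hz]
  exact P.add_mem (P.smul_mem _ (hmem ξ hξ)) (hJ.ge (Submodule.mem_top (x := Fin.tail z - z 0 • ξ)))

end FirstRow

section Expansion

variable {m : ℕ} {W : Type*} [NormedAddCommGroup W] [NormedSpace ℝ W] [FiniteDimensional ℝ W]

lemma fixed_of_rowsIn {ρ : SpecialLinearGroup (Fin (m + 1)) ℝ →* Module.End ℝ W}
    (hcont : ∀ v : W, Continuous fun g => ρ g v) {Ξ : Set (Fin m → ℝ)} {v : W}
    (hv : ∀ ξ ∈ Ξ, ForwardBounded (fun t => ρ (aSL m t * uSL m ξ)) v)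
    {g : SpecialLinearGroup (Fin (m + 1)) ℝ} (hg : RowsIn ((fun ξ => uMat m ξ 0) '' Ξ) g)
    (i : Fin (m + 1)) (t : ℝ) : ρ (expDiag (t • expandDir i)) (ρ g v) = ρ g v := by
  refine fixed_of_forwardBounded (Ψ := fun e => ρ (expDiag e)) (by simp [expDiag_zero])
    (fun x y => by simp [expDiag_add]) sum_expandDir (exists_actsDiagonally hcont) (fun i => ?_) i t
  obtain ⟨_, ⟨ξ, hξ, rfl⟩, c, hc⟩ := hg i
  exact forwardBounded_expandDir hcont hc (hv ξ hξ)

lemma fixed_of_forwardBounded_translates (hm : 1 ≤ m)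
    {ρ : SpecialLinearGroup (Fin (m + 1)) ℝ →* Module.End ℝ W}
    (hcont : ∀ v : W, Continuous fun g => ρ g v) {Ξ : Set (Fin m → ℝ)} (hΞ : IsPreconnected Ξ)
    (hflat : ∀ W : Submodule ℝ (Fin m → ℝ), (∀ x ∈ Ξ, ∀ y ∈ Ξ, x - y ∈ W) → W = ⊤) {v : W}
    (hv : ∀ ξ ∈ Ξ, ForwardBounded (fun t => ρ (aSL m t * uSL m ξ)) v)
    (g : SpecialLinearGroup (Fin (m + 1)) ℝ) : ρ g v = v := by
  let S : Subgroup (SpecialLinearGroup (Fin (m + 1)) ℝ) :=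
    { carrier := {g | ρ g v = v}
      mul_mem' := fun {g h} (hg : ρ g v = v) (hh : ρ h v = v) => show ρ (g * h) v = v by
        rw [map_mul, Module.End.mul_apply, hh, hg]
      one_mem' := by simp
      inv_mem' := fun {g} (hg : ρ g v = v) => show ρ g⁻¹ v = v by
        conv_lhs => rw [← hg]
        rw [← Module.End.mul_apply, ← map_mul, inv_mul_cancel, map_one, Module.End.one_apply] }
  have : Nontrivial (Fin (m + 1)) := Fin.nontrivial_iff_two_le.mpr (by lia)
  have htop : S = ⊤ := by
    refine eq_top_of_rowsIn (hΞ.image _ continuous_uMat_zero.continuousOn) ?_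
      (span_uMat_zero hm hflat) fun g hg i t => ?_
    · rintro ⟨ξ, -, h⟩
      simpa [uMat_zero] using congrFun h 0
    · change ρ (g⁻¹ * expDiag (t • expandDir i) * g) v = v
      rw [map_mul, map_mul, Module.End.mul_apply, Module.End.mul_apply,
        fixed_of_rowsIn hcont hv hg, ← Module.End.mul_apply, ← map_mul, inv_mul_cancel, map_one,
        Module.End.one_apply]
  exact htop.ge (Subgroup.mem_top g)

lemma exists_norm_le_abs_apply {κ : Type*} (ℓ : κ → W →ₗ[ℝ] ℝ)
    (hℓ : ∀ v, (∀ k, ℓ k v = 0) → v = 0) :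
    ∃ ε : ℝ, 0 < ε ∧ ∀ v, v ≠ 0 → ∃ k, ε * ‖v‖ ≤ |ℓ k v| := by
  have := FiniteDimensional.proper ℝ W
  let U : ℕ → Set W := fun n => {v | ∃ k, 1 / ((n : ℝ) + 1) < |ℓ k v|}
  have hopen : ∀ n, IsOpen (U n) := by
    intro n
    simp only [U, Set.ofPred_exists]
    exact isOpen_iUnion fun k => isOpen_lt continuous_const
      (LinearMap.continuous_of_finiteDimensional (ℓ k)).abs
  have hmono : Monotone U := fun n n' hn v ⟨k, hk⟩ =>
    ⟨k, (one_div_le_one_div_of_le (by positivity) (by gcongr)).trans_lt hk⟩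
  have hcover : Metric.sphere (0 : W) 1 ⊆ ⋃ n, U n := by
    intro v hv
    have hv0 : v ≠ 0 := by
      rintro rfl
      simp at hv
    obtain ⟨k, hk⟩ : ∃ k, ℓ k v ≠ 0 := by
      by_contra! h
      exact hv0 (hℓ v h)
    obtain ⟨n, hn⟩ := exists_nat_one_div_lt (abs_pos.mpr hk)
    exact Set.mem_iUnion.mpr ⟨n, k, hn⟩
  obtain ⟨n, hn⟩ := (isCompact_sphere (0 : W) 1).elim_directed_cover U hopen hcover
    hmono.directed_le
  refine ⟨1 / ((n : ℝ) + 1), by positivity, fun v hv => ?_⟩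
  obtain ⟨k, hk⟩ := hn (show ‖v‖⁻¹ • v ∈ Metric.sphere (0 : W) 1 by
    simpa using norm_smul_inv_norm (𝕜 := ℝ) hv)
  refine ⟨k, ?_⟩
  rw [map_smul, smul_eq_mul, abs_mul, abs_inv, abs_norm,
    lt_inv_mul_iff₀ (norm_pos_iff.mpr hv)] at hk
  linarith

end Expansion

/-- Corollary 4.7 (cor:expand) of the paper. Let `φ : [a,b] → ℝ^{n-1}` be a
differentiable curve whose image is not contained in a proper affine subspace, and
let `V` be a finite-dimensional normed representation of `G = SL(n, ℝ)` with no
nonzero `G`-fixed vectors. Then for every `C > 0` there is `t₀ > 0` such that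
`sup_{s ∈ [a,b]} ‖a_t u(φ(s)) v‖ ≥ C ‖v‖` for all `v ∈ V` and all `t > t₀`. -/
theorem sup_norm_translate_expands {m : ℕ} (hm : 1 ≤ m)
    {V : Type*} [NormedAddCommGroup V] [NormedSpace ℝ V] [FiniteDimensional ℝ V]
    (ρ : Matrix.SpecialLinearGroup (Fin (m + 1)) ℝ →* Module.End ℝ V)
    (hcont : ∀ v : V, Continuous fun g => ρ g v)
    (hnofix : ∀ v : V, (∀ g : Matrix.SpecialLinearGroup (Fin (m + 1)) ℝ, ρ g v = v)
      → v = 0)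
    (a b : ℝ) (φ : ℝ → Fin m → ℝ)
    (hdiff : ∀ s ∈ Set.Icc a b, DifferentiableAt ℝ φ s)
    (hflat : ¬ ∃ W : Submodule ℝ (Fin m → ℝ), W ≠ ⊤ ∧
      ∀ s ∈ Set.Icc a b, ∀ s' ∈ Set.Icc a b, φ s - φ s' ∈ W) :
    ∀ C : ℝ, 0 < C → ∃ t₀ : ℝ, 0 < t₀ ∧ ∀ (v : V) (t : ℝ), t₀ < t →
      C * ‖v‖ ≤ ⨆ s ∈ Set.Icc a b, ‖ρ (aSL m t * uSL m (φ s)) v‖ := by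
  intro C _
  obtain ⟨d, e, μ, he⟩ := exists_actsDiagonally hcont 0
  simp only [← aSL_eq_expDiag] at he
  have hφ : ContinuousOn φ (Set.Icc a b) := fun s hs =>
    (hdiff s hs).continuousAt.continuousWithinAt
  let ℓ : Set.Icc a b × {i // 0 < μ i} → V →ₗ[ℝ] ℝ := fun k =>
    e.coord k.2 ∘ₗ ρ (uSL m (φ k.1))
  obtain ⟨ε, hε, hεv⟩ := exists_norm_le_abs_apply ℓ fun v hv => by
    refine hnofix v (fixed_of_forwardBounded_translates hm hcont (isPreconnected_Icc.image φ hφ)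
      (fun W hW => by_contra fun hne => hflat ⟨W, hne, fun s hs s' hs' =>
        hW _ ⟨s, hs, rfl⟩ _ ⟨s', hs', rfl⟩⟩) ?_)
    rintro _ ⟨s, hs, rfl⟩
    simp only [map_mul]
    exact he.forwardBounded fun i hi => hv ⟨⟨s, hs⟩, ⟨i, hi⟩⟩
  obtain ⟨K, hK, hKx⟩ := exists_abs_repr_le e
  have hev : ∀ᶠ t in Filter.atTop, ∀ i, 0 < μ i → C * K / ε ≤ Real.exp (μ i * t) := by
    refine Filter.eventually_all.mpr fun i => ?_
    by_cases hi : 0 < μ i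
    · have h := Real.tendsto_exp_atTop.comp (Filter.tendsto_id.const_mul_atTop hi)
      exact (h.eventually_ge_atTop (C * K / ε)).mono fun t ht _ => ht
    · exact Filter.Eventually.of_forall fun t h => (hi h).elim
  obtain ⟨t₁, ht₁⟩ := Filter.eventually_atTop.mp hev
  refine ⟨max t₁ 1, by positivity, fun v t ht => ?_⟩
  rcases eq_or_ne v 0 with rfl | hv
  · simp
  have hbdd : BddAbove (Set.range fun s =>
      ⨆ _ : s ∈ Set.Icc a b, ‖ρ (aSL m t * uSL m (φ s)) v‖) := by
    have hc : ContinuousOn (fun s => ρ (aSL m t * uSL m (φ s)) v) (Set.Icc a b) := by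
      simp only [map_mul, Module.End.mul_apply]
      exact (LinearMap.continuous_of_finiteDimensional (ρ (aSL m t))).comp_continuousOn
        (((hcont v).comp continuous_uSL).comp_continuousOn hφ)
    obtain ⟨B, hB⟩ := isCompact_Icc.exists_bound_of_continuousOn hc
    refine ⟨max B 0, ?_⟩
    rintro _ ⟨s, rfl⟩
    exact Real.iSup_le (fun hs => (hB s hs).trans (le_max_left _ _)) (le_max_right _ _)
  obtain ⟨⟨⟨s, hs⟩, ⟨i, hi⟩⟩, hsi⟩ := hεv v hv
  refine le_ciSup_of_le hbdd s ?_
  rw [ciSup_pos hs, map_mul, Module.End.mul_apply]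
  have h1 := hKx (ρ (aSL m t) (ρ (uSL m (φ s)) v)) i
  rw [he.repr_apply, abs_mul, Real.abs_exp] at h1
  have h2 := ht₁ t ((le_max_left _ _).trans ht.le) i hi
  rw [div_le_iff₀ hε] at h2
  refine le_of_mul_le_mul_left ?_ hK
  calc K * (C * ‖v‖) = C * K * ‖v‖ := by ring
    _ ≤ Real.exp (μ i * t) * ε * ‖v‖ := by gcongr
    _ = Real.exp (μ i * t) * (ε * ‖v‖) := by ring
    _ ≤ Real.exp (μ i * t) * |e.repr (ρ (uSL m (φ s)) v) i| := by gcongr; exact hsi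
    _ ≤ _ := h1
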